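/- arXiv:1706.04846 — 3 statements merged into one kernel-verified Lean document; each statement's English description precedes it below -/
import Mathlib

section
/- Let C be a nonempty closed convex subset and D a nonempty closed subset of a Euclidean space X with C ∩ D ≠ ∅, and let (x_n) be a sequence with x_{n+1} ∈ T_{C,D}(x_n) for all n. If (x_n) is asymptotically regular (x_n − x_{n+1} → 0) and x is a cluster point of (x_n), then P_C(x) ∈ C ∩ D. -/
open Metric Filter

/-- The (possibly set-valued) projector onto a set `C`. -/
def projSet {X : Type*} [NormedAddCommGroup X] (C : Set X) (x : X) : Set X :=
  {c | c ∈ C ∧ ‖x - c‖ = infDist x C}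

/-- The (possibly set-valued) reflector across a set `C`. -/
def reflSet {X : Type*} [NormedAddCommGroup X] (C : Set X) (x : X) : Set X :=
  {w | ∃ c ∈ projSet C x, w = 2 • c - x}

/-- The Douglas–Rachford operator `T_{C,D}(x) = {(x+w)/2 : w ∈ R_D(v), v ∈ R_C(x)}`. -/
def drSet {X : Type*} [NormedAddCommGroup X] [Module ℝ X] (C D : Set X) (x : X) : Set X :=
  {z | ∃ v ∈ reflSet C x, ∃ w ∈ reflSet D v, z = (2 : ℝ)⁻¹ • (x + w)}

/-- Variational characterization of the projection onto a convex set. -/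
theorem inner_le_zero_of_mem_projSet {X : Type*} [NormedAddCommGroup X]
    [InnerProductSpace ℝ X] {C : Set X} (hC : Convex ℝ C) {x c y : X}
    (hc : c ∈ projSet C x) (hy : y ∈ C) : inner ℝ (x - c) (y - c) ≤ 0 := by
  refine (norm_eq_iInf_iff_real_inner_le_zero hC hc.1).1 ?_ y hy
  simpa only [infDist_eq_iInf, dist_eq_norm] using hc.2

/-- The projection onto a convex set is nonexpansive. -/
theorem norm_sub_le_of_mem_projSet {X : Type*} [NormedAddCommGroup X]
    [InnerProductSpace ℝ X] {C : Set X} (hC : Convex ℝ C) {x y c d : X}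
    (hc : c ∈ projSet C x) (hd : d ∈ projSet C y) : ‖c - d‖ ≤ ‖x - y‖ := by
  have h₁ := inner_le_zero_of_mem_projSet hC hc hd.1
  have h₂ := inner_le_zero_of_mem_projSet hC hd hc.1
  have h₃ : inner ℝ (x - y) (c - d) =
      ‖c - d‖ ^ 2 - inner ℝ (x - c) (d - c) - inner ℝ (y - d) (c - d) := by
    rw [← real_inner_self_eq_norm_sq]
    simp only [inner_sub_left, inner_sub_right]
    ring
  have h₄ := real_inner_le_norm (x - y) (c - d)
  rcases (norm_nonneg (c - d)).eq_or_lt with h | h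
  · exact h ▸ norm_nonneg _
  · exact le_of_mul_le_mul_right (by nlinarith) h

/-- A Douglas–Rachford step is `x ↦ x - c + d` with `c ∈ P_C x` and `d ∈ D`. -/
theorem exists_sub_eq_of_mem_drSet {X : Type*} [NormedAddCommGroup X] [Module ℝ X]
    {C D : Set X} {x z : X} (hz : z ∈ drSet C D x) :
    ∃ c ∈ projSet C x, ∃ d ∈ D, x - z = c - d := by
  obtain ⟨_, ⟨c, hc, rfl⟩, _, ⟨d, hd, rfl⟩, rfl⟩ := hz
  exact ⟨c, hc, d, hd.1, by module⟩

/-- If `C` is nonempty closed convex, `D` is nonempty closed, `C ∩ D ≠ ∅`, `(x_n)` is a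
DR sequence which is asymptotically regular and `p` is a cluster point of `(x_n)`,
then the projection `P_C(p)` belongs to `C ∩ D`. -/
theorem stmt1 {X : Type*} [NormedAddCommGroup X] [InnerProductSpace ℝ X]
    [FiniteDimensional ℝ X]
    (C D : Set X) (hCne : C.Nonempty) (hCc : IsClosed C) (hCv : Convex ℝ C)
    (hDne : D.Nonempty) (hDc : IsClosed D) (hCD : (C ∩ D).Nonempty)
    (x : ℕ → X) (hseq : ∀ n, x (n + 1) ∈ drSet C D (x n))
    (hreg : Tendsto (fun n => x n - x (n + 1)) atTop (nhds 0))
    (p : X) (hp : MapClusterPt p atTop x) :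
    (projSet C p).Nonempty ∧ ∀ q ∈ projSet C p, q ∈ C ∩ D := by
  obtain ⟨q₀, hq₀, hdist⟩ := hCc.exists_infDist_eq_dist hCne p
  refine ⟨⟨q₀, hq₀, by rw [hdist, dist_eq_norm]⟩, fun q hq => ⟨hq.1, ?_⟩⟩
  choose c hc d hd hcd using fun n => exists_sub_eq_of_mem_drSet (hseq n)
  obtain ⟨φ, hφ, hφp⟩ := hp.tendsto_subseq
  have hcq : Tendsto (c ∘ φ) atTop (nhds q) :=
    tendsto_iff_norm_sub_tendsto_zero.2 <|
      squeeze_zero (fun _ => norm_nonneg _)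
        (fun k => norm_sub_le_of_mem_projSet hCv (hc (φ k)) hq)
        (tendsto_iff_norm_sub_tendsto_zero.1 hφp)
  have hdq : Tendsto (d ∘ φ) atTop (nhds q) := by
    have h := hcq.sub (hreg.comp hφ.tendsto_atTop)
    rw [sub_zero] at h
    refine h.congr fun k => ?_
    simp [hcd]
  exact hDc.mem_of_tendsto hdq (Eventually.of_forall fun k => hd (φ k))
end

section
/- Suppose that f is convex and that f⁻¹(0) is contained in the interior of dom f, and assume A ∩ B ≠ ∅. Then Fix T_{A,B} ⊆ (A ∩ B) ∪ ({x ∈ f⁻¹(0) : 0 ∈ ∂f(x)} × (ℝ ∖ {0})). In particular, if inf_{x ∈ X} f(x) < 0, then Fix T_{A,B} = A ∩ B. -/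
open Set Metric Filter
open scoped InnerProductSpace

/-- The Euclidean (ℓ²) distance on the product `X × ℝ`. -/
noncomputable def dist2 {X : Type*} [NormedAddCommGroup X] (z w : X × ℝ) : ℝ :=
  Real.sqrt (‖z.1 - w.1‖ ^ 2 + (z.2 - w.2) ^ 2)

/-- The graph `B = {(x, ρ) : x ∈ dom f, f(x) = ρ}` of the extended-real-valued function
encoded by its effective domain `s` and its real values `f` on `s`. -/
def grph {X : Type*} (s : Set X) (f : X → ℝ) : Set (X × ℝ) :=
  {p | p.1 ∈ s ∧ f p.1 = p.2}

/-- The (possibly set-valued) projector onto the graph `B`, for the Euclidean metric on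
`X × ℝ`: the set of points of `B` nearest to `z`. -/
noncomputable def projB {X : Type*} [NormedAddCommGroup X] (s : Set X) (f : X → ℝ)
    (z : X × ℝ) : Set (X × ℝ) :=
  {b | b ∈ grph s f ∧ ∀ b' ∈ grph s f, dist2 z b ≤ dist2 z b'}

/-- The reflector across `A = X × {0}`: `R_A(x, ρ) = (x, -ρ)`. -/
def reflA {X : Type*} (z : X × ℝ) : X × ℝ := (z.1, -z.2)

/-- The Douglas–Rachford operator `T_{A,B}(z) = {(z + w)/2 : w ∈ R_B(R_A z)}`,
where `R_B(v) = {2b - v : b ∈ P_B(v)}`. -/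
noncomputable def drT {X : Type*} [NormedAddCommGroup X] [Module ℝ X] (s : Set X)
    (f : X → ℝ) (z : X × ℝ) : Set (X × ℝ) :=
  {w | ∃ b ∈ projB s f (reflA z), w = (2 : ℝ)⁻¹ • (z + (2 • b - reflA z))}

/-- The fixed point set of the Douglas–Rachford operator. -/
noncomputable def fixT {X : Type*} [NormedAddCommGroup X] [Module ℝ X]
    (s : Set X) (f : X → ℝ) : Set (X × ℝ) :=
  {z | z ∈ drT s f z}

/-- The convex subdifferential of the extended function encoded by `(s, F)` at `p`. -/
def subdiff {X : Type*} [NormedAddCommGroup X] [InnerProductSpace ℝ X]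
    (s : Set X) (F : X → ℝ) (p : X) : Set X :=
  {v | p ∈ s ∧ ∀ y ∈ s, F p + ⟪v, y - p⟫_ℝ ≤ F y}

/-- `z` is a fixed point of the Douglas–Rachford operator iff `(z.1, 0)` is a point of the graph
nearest to `(z.1, -z.2)`, written out with squared distances. -/
lemma mem_fixT_iff {X : Type*} [NormedAddCommGroup X] [InnerProductSpace ℝ X]
    {s : Set X} {f : X → ℝ} {z : X × ℝ} :
    z ∈ fixT s f ↔ (z.1 ∈ s ∧ f z.1 = 0) ∧
      ∀ y ∈ s, 0 ≤ ‖z.1 - y‖ ^ 2 + 2 * z.2 * f y + f y ^ 2 := by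
  obtain ⟨x, r⟩ := z
  have key : (x, (0 : ℝ)) ∈ projB s f (reflA (x, r)) ↔ (x ∈ s ∧ f x = 0) ∧
      ∀ y ∈ s, 0 ≤ ‖x - y‖ ^ 2 + 2 * r * f y + f y ^ 2 := by
    simp only [projB, grph, reflA, dist2, mem_ofPred_eq, Prod.forall]
    refine and_congr_right fun _ => ⟨fun h y hy => ?_, fun h y q hq => ?_⟩
    · have := (Real.sqrt_le_sqrt_iff (by positivity)).1 (h y (f y) ⟨hy, rfl⟩)
      simp only [sub_self, norm_zero] at this
      nlinarith
    · obtain ⟨hy, rfl⟩ := hq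
      refine Real.sqrt_le_sqrt ?_
      have := h y hy
      simp only [sub_self, norm_zero]
      nlinarith
  have half (b : X) : (2 : ℝ)⁻¹ • 2 • b = b := by module
  rw [← key]
  constructor
  · rintro ⟨⟨b₁, b₂⟩, hb, he⟩
    have h1 : b₁ = x := by
      have := congrArg Prod.fst he
      simp [reflA, half] at this
      exact this.symm
    have h2 : b₂ = 0 := by
      have := congrArg Prod.snd he
      simp [reflA] at this
      linarith
    rwa [h1, h2] at hb
  · refine fun hb => ⟨_, hb, ?_⟩
    ext
    · simp [reflA, half]
    · simp [reflA]
      ring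

/-- A quadratic `a t² - b t` with `b > 0` is negative somewhere on `(0, 1]`. -/
lemma exists_quadratic_neg (a : ℝ) {b : ℝ} (hb : 0 < b) :
    ∃ t : ℝ, 0 < t ∧ t ≤ 1 ∧ a * t ^ 2 - b * t < 0 := by
  have hp : 0 < |a| + b := by positivity
  have ht : 0 < b / (|a| + b) := by positivity
  refine ⟨b / (|a| + b), ht, (div_le_one hp).2 (by linarith [abs_nonneg a]), ?_⟩
  have hm : b / (|a| + b) * (|a| + b) = b := div_mul_cancel₀ _ hp.ne'
  generalize b / (|a| + b) = t at *
  have h1 : a * t < b := by nlinarith [le_abs_self a, mul_pos ht hb]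
  nlinarith

/-- A point of the interior of `s` can be pushed slightly in any direction. -/
lemma exists_pos_sub_smul_mem {X : Type*} [NormedAddCommGroup X] [InnerProductSpace ℝ X]
    {s : Set X} {x : X} (hx : x ∈ interior s) (d : X) : ∃ e : ℝ, 0 < e ∧ x - e • d ∈ s := by
  have hc : Tendsto (fun e : ℝ => x - e • d) (nhdsWithin 0 (Ioi 0)) (nhds x) := by
    have : ContinuousAt (fun e : ℝ => x - e • d) 0 := by fun_prop
    have h := this.tendsto
    simp only [zero_smul, sub_zero] at h
    exact h.mono_left nhdsWithin_le_nhds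
  obtain ⟨e, h, he⟩ := ((hc.eventually (mem_interior_iff_mem_nhds.1 hx)).and
    self_mem_nhdsWithin).exists
  exact ⟨e, he, h⟩

/-- If `f` takes a negative value, then fixed points lie in `A`. -/
lemma snd_eq_zero_of_mem_fixT {X : Type*} [NormedAddCommGroup X] [InnerProductSpace ℝ X]
    {s : Set X} {f : X → ℝ} (hconv : ConvexOn ℝ s f)
    (hint : {x | x ∈ s ∧ f x = 0} ⊆ interior s) {z : X × ℝ} (hz : z ∈ fixT s f)
    {y : X} (hy : y ∈ s) (hneg : f y < 0) : z.2 = 0 := by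
  obtain ⟨⟨hxs, hx0⟩, hmin⟩ := mem_fixT_iff.1 hz
  obtain ⟨x, r⟩ := z
  dsimp only at *
  obtain ⟨e, he, hu⟩ := exists_pos_sub_smul_mem (hint ⟨hxs, hx0⟩) (y - x)
  set d := y - x with hd
  set K := f (x - e • d)
  -- the values of `f` on either side of `x` along the line through `x` and `y`
  have hline : ∀ t : ℝ, 0 ≤ t → t ≤ 1 → (x + t • d ∈ s ∧ f (x + t • d) ≤ t * f y) ∧
      (x - (t * e) • d ∈ s ∧ f (x - (t * e) • d) ≤ t * K) ∧
      0 ≤ f (x - (t * e) • d) + e * f (x + t • d) := by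
    intro t h0 h1
    have hp : (1 - t) • x + t • y = x + t • d := by rw [hd]; module
    have hq : (1 - t) • x + t • (x - e • d) = x - (t * e) • d := by module
    have hps := hconv.1 hxs hy (sub_nonneg.2 h1) h0 (by ring)
    have hqs := hconv.1 hxs hu (sub_nonneg.2 h1) h0 (by ring)
    have hpf := hconv.2 hxs hy (sub_nonneg.2 h1) h0 (by ring)
    have hqf := hconv.2 hxs hu (sub_nonneg.2 h1) h0 (by ring)
    rw [hp] at hps hpf
    rw [hq] at hqs hqf
    simp only [hx0, smul_eq_mul, mul_zero, zero_add] at hpf hqf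
    refine ⟨⟨hps, hpf⟩, ⟨hqs, hqf⟩, ?_⟩
    have he1 : 0 < 1 + e := by linarith
    have hmid := hconv.2 hqs hps (show 0 ≤ 1 / (1 + e) by positivity)
      (show 0 ≤ e / (1 + e) by positivity) (by field_simp)
    have hx : (1 / (1 + e)) • (x - (t * e) • d) + (e / (1 + e)) • (x + t • d) = x := by
      match_scalars
      · field_simp
        ring
      · field_simp
        ring
    rw [hx, hx0, smul_eq_mul, smul_eq_mul, div_mul_eq_mul_div, div_mul_eq_mul_div, ← add_div,
      one_mul] at hmid
    simpa using (le_div_iff₀ he1).1 hmid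
  by_contra hr
  rcases lt_or_gt_of_ne hr with hr | hr
  · obtain ⟨t, ht0, ht1, ht⟩ := exists_quadratic_neg (e ^ 2 * ‖d‖ ^ 2 + K ^ 2)
      (b := 2 * r * (e * f y)) (by nlinarith [mul_pos he (neg_pos.2 hneg)])
    obtain ⟨⟨-, hpf⟩, ⟨hqs, hqf⟩, hm⟩ := hline t ht0.le ht1
    have h := hmin _ hqs
    rw [sub_sub_cancel, norm_smul, mul_pow, Real.norm_eq_abs, sq_abs] at h
    have hlow : -(t * (e * f y)) ≤ f (x - (t * e) • d) := by nlinarith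
    have hpos : 0 < -(t * (e * f y)) := by
      nlinarith [mul_pos ht0 (mul_pos he (neg_pos.2 hneg))]
    have hsq : f (x - (t * e) • d) ^ 2 ≤ (t * K) ^ 2 :=
      pow_le_pow_left₀ (hpos.le.trans hlow) hqf 2
    nlinarith
  · obtain ⟨t, ht0, ht1, ht⟩ := exists_quadratic_neg (‖d‖ ^ 2 + (K / e) ^ 2)
      (b := -(2 * r * f y)) (by nlinarith)
    obtain ⟨⟨hps, hpf⟩, ⟨-, hqf⟩, hm⟩ := hline t ht0.le ht1
    have h := hmin _ hps
    rw [sub_add_cancel_left, norm_neg, norm_smul, mul_pow, Real.norm_eq_abs, sq_abs] at h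
    have hlow : -f (x + t • d) ≤ t * (K / e) := by
      rw [← mul_div_assoc, le_div_iff₀ he]
      linarith
    have hpos : 0 ≤ -f (x + t • d) := by nlinarith
    have hsq := pow_le_pow_left₀ hpos hlow 2
    nlinarith

/-- Suppose `f` is convex, `f⁻¹(0) ⊆ int dom f`, and `A ∩ B ≠ ∅`.  Then
`Fix T_{A,B} ⊆ (A ∩ B) ∪ ({x ∈ f⁻¹(0) : 0 ∈ ∂f(x)} × (ℝ ∖ {0}))`; in particular if
`inf f < 0` then `Fix T_{A,B} = A ∩ B`. -/
theorem stmt10 {X : Type*} [NormedAddCommGroup X] [InnerProductSpace ℝ X]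
    [FiniteDimensional ℝ X]
    (s : Set X) (f : X → ℝ) (hs : s.Nonempty) (hconv : ConvexOn ℝ s f)
    (hB : IsClosed (grph s f))
    (hint : {x | x ∈ s ∧ f x = 0} ⊆ interior s)
    (hAB : ∃ x ∈ s, f x = 0) :
    fixT s f ⊆ ({z : X × ℝ | z.2 = 0} ∩ grph s f) ∪
      {z : X × ℝ | (z.1 ∈ s ∧ f z.1 = 0 ∧ (0 : X) ∈ subdiff s f z.1) ∧ z.2 ≠ 0} ∧
    ((∃ x ∈ s, f x < 0) → fixT s f = {z : X × ℝ | z.2 = 0} ∩ grph s f) := by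
  have hmain : ∀ z ∈ fixT s f, z.2 ≠ 0 → ∀ y ∈ s, 0 ≤ f y := fun z hz hz2 y hy =>
    not_lt.1 fun hneg => hz2 (snd_eq_zero_of_mem_fixT hconv hint hz hy hneg)
  refine ⟨fun z hz => ?_, fun ⟨y, hy, hneg⟩ => Subset.antisymm (fun z hz => ?_) ?_⟩
  · obtain ⟨⟨hzs, hz0⟩, -⟩ := mem_fixT_iff.1 hz
    by_cases h : z.2 = 0
    · exact Or.inl ⟨h, hzs, hz0.trans h.symm⟩
    · refine Or.inr ⟨⟨hzs, hz0, hzs, fun y hy => ?_⟩, h⟩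
      simpa [hz0] using hmain z hz h y hy
  · obtain ⟨⟨hzs, hz0⟩, -⟩ := mem_fixT_iff.1 hz
    have h := snd_eq_zero_of_mem_fixT hconv hint hz hy hneg
    exact ⟨h, hzs, hz0.trans h.symm⟩
  · rintro z ⟨h, hzs, hz0⟩
    rw [mem_ofPred_eq] at h
    refine mem_fixT_iff.2 ⟨⟨hzs, hz0.trans h⟩, fun y _ => ?_⟩
    rw [h]
    nlinarith [sq_nonneg ‖z.1 - y‖, sq_nonneg (f y)]
end

section
/- Suppose X = ℝ. Let x̄ ∈ ℝ with f(x̄) = 0, suppose f is differentiable on a neighborhood of x̄ with f' strictly differentiable at x̄ (i.e., f is twice strictly differentiable at x̄), and suppose f'(x̄) ≠ 0. Set z̄ := (x̄, 0) ∈ A ∩ B and κ := 1/√(1 + |f'(x̄)|²). Then there exists δ > 0 such that T_{A,B} is single-valued on the closed ball B(z̄, δ), maps B(z̄, δ) into itself, is a contraction on B(z̄, δ), and for every DR sequence (z_n) with z_0 ∈ B(z̄, δ) one has z_n → z̄ with Q-linear rate κ, i.e. limsup_{n→∞} ‖z_{n+1} − z̄‖/‖z_n − z̄‖ ≤ κ.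 -/
open Set Metric Filter
open scoped InnerProductSpace

open Topology

lemma dist2_nonneg {X : Type*} [NormedAddCommGroup X] (z w : X × ℝ) : 0 ≤ dist2 z w :=
  Real.sqrt_nonneg _

lemma dist2_sq {X : Type*} [NormedAddCommGroup X] (z w : X × ℝ) :
    dist2 z w ^ 2 = ‖z.1 - w.1‖ ^ 2 + (z.2 - w.2) ^ 2 :=
  Real.sq_sqrt (by positivity)

lemma dist2_self {X : Type*} [NormedAddCommGroup X] (z : X × ℝ) : dist2 z z = 0 := by
  simp [dist2]

lemma norm_fst_sub_le_dist2 {X : Type*} [NormedAddCommGroup X] (z w : X × ℝ) :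
    ‖z.1 - w.1‖ ≤ dist2 z w :=
  Real.le_sqrt_of_sq_le (le_add_of_nonneg_right (sq_nonneg _))

lemma abs_snd_sub_le_dist2 {X : Type*} [NormedAddCommGroup X] (z w : X × ℝ) :
    |z.2 - w.2| ≤ dist2 z w :=
  Real.le_sqrt_of_sq_le (by rw [sq_abs]; exact le_add_of_nonneg_left (sq_nonneg _))

/-- The product (sup) distance is bounded by the Euclidean one. -/
lemma dist_le_dist2 {X : Type*} [NormedAddCommGroup X] (z w : X × ℝ) :
    dist z w ≤ dist2 z w := by
  rw [Prod.dist_eq, dist_eq_norm, Real.dist_eq]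
  exact max_le (norm_fst_sub_le_dist2 z w) (abs_snd_sub_le_dist2 z w)

/-- A nonempty closed graph has a nearest point to every point. -/
lemma projB_nonempty {s : Set ℝ} {f : ℝ → ℝ} (hB : IsClosed (grph s f))
    (hne : (grph s f).Nonempty) (v : ℝ × ℝ) : (projB s f v).Nonempty := by
  obtain ⟨b₀, hb₀⟩ := hne
  have hcont : Continuous (dist2 v) := by unfold dist2; fun_prop
  have hcomp : IsCompact (grph s f ∩ closedBall v (dist2 v b₀)) :=
    (isCompact_closedBall _ _).inter_left hB
  obtain ⟨b, hb, hmin⟩ := hcomp.exists_isMinOn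
    ⟨b₀, hb₀, by rw [mem_closedBall, dist_comm]; exact dist_le_dist2 _ _⟩ hcont.continuousOn
  refine ⟨b, hb.1, fun b' hb' => ?_⟩
  by_cases h : dist2 v b' ≤ dist2 v b₀
  · refine hmin ⟨hb', ?_⟩
    rw [mem_closedBall, dist_comm]
    exact (dist_le_dist2 _ _).trans h
  · refine (hmin ⟨hb₀, ?_⟩).trans (not_le.mp h).le
    rw [mem_closedBall, dist_comm]
    exact dist_le_dist2 _ _

/-- The elements of `T_{A,B}(x, ρ)` are the points `(p, ρ + f p)` with `(p, f p)` a projection of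
`(x, -ρ)` onto the graph. -/
lemma mem_drT_iff {s : Set ℝ} {f : ℝ → ℝ} {z w : ℝ × ℝ} :
    w ∈ drT s f z ↔ (w.1, f w.1) ∈ projB s f (reflA z) ∧ w.2 = z.2 + f w.1 := by
  constructor
  · rintro ⟨⟨p, q⟩, hb, rfl⟩
    obtain rfl : f p = q := hb.1.2
    have hmid : (2 : ℝ)⁻¹ • (z + (2 • (p, f p) - reflA z)) = (p, z.2 + f p) := by
      ext <;> simp [reflA] <;> ring
    rw [hmid]
    exact ⟨hb, rfl⟩
  · rintro ⟨hb, h⟩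
    refine ⟨_, hb, Prod.ext ?_ ?_⟩
    · simp [reflA]; ring
    · simp [reflA, h]; ring

/-- Any `w ∈ T_{A,B}(z)` is close to a point `(x̄, 0)` of the graph whenever `z` is. -/
lemma abs_sub_le_of_mem_drT {s : Set ℝ} {f : ℝ → ℝ} {xbar : ℝ} (hxs : xbar ∈ s)
    (hfx : f xbar = 0) {z w : ℝ × ℝ} (hw : w ∈ drT s f z) :
    |w.1 - xbar| ≤ 2 * dist2 z (xbar, 0) ∧ |w.2| ≤ dist2 z (xbar, 0) := by
  obtain ⟨⟨-, hmin⟩, hw2⟩ := mem_drT_iff.mp hw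
  have hle := hmin (xbar, 0) ⟨hxs, hfx⟩
  have hrefl : dist2 (reflA z) (xbar, 0) = dist2 z (xbar, 0) := by simp [dist2, reflA]
  rw [hrefl] at hle
  have h₁ := (norm_fst_sub_le_dist2 _ _).trans hle
  have h₂ := (abs_snd_sub_le_dist2 _ _).trans hle
  have h₃ := norm_fst_sub_le_dist2 z (xbar, 0)
  simp only [reflA, Real.norm_eq_abs] at h₁ h₂ h₃
  rw [abs_le] at *
  rw [abs_le]
  constructor <;> constructor <;> linarith

/-- First-order optimality: `T_{A,B}` is inverted by `(p, σ) ↦ (p + σ f'(p), σ - f(p))`. -/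
lemma fst_eq_of_mem_drT {s : Set ℝ} {f : ℝ → ℝ} {z w : ℝ × ℝ} {m : ℝ} (hw : w ∈ drT s f z)
    (hs : s ∈ 𝓝 w.1) (hf : HasDerivAt f m w.1) : z.1 = w.1 + w.2 * m := by
  obtain ⟨⟨-, hmin⟩, hw2⟩ := mem_drT_iff.mp hw
  have hloc : IsLocalMin (fun p => (z.1 - p) ^ 2 + (-z.2 - f p) ^ 2) w.1 := by
    filter_upwards [hs] with p hp
    have h := pow_le_pow_left₀ (dist2_nonneg _ _) (hmin (p, f p) ⟨hp, rfl⟩) 2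
    rw [dist2_sq, dist2_sq] at h
    simpa [reflA] using h
  have hd : HasDerivAt (fun p => (z.1 - p) ^ 2 + (-z.2 - f p) ^ 2)
      (2 * (z.1 - w.1) * (-1) + 2 * (-z.2 - f w.1) * (-m)) w.1 := by
    have h := (((hasDerivAt_id w.1).const_sub z.1).pow 2).add ((hf.const_sub (-z.2)).pow 2)
    exact h.congr_deriv (by norm_num)
  have h0 := hloc.hasDerivAt_eq_zero hd
  rw [hw2]
  linarith

/-- Perturbing `(u, v) ↦ (u + a v, v - a u)`, which scales Euclidean lengths by `√(1 + a²)`,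
by a small error. -/
lemma le_sq_add_sq_of_abs_le {a u v d e η : ℝ}
    (hd : |d - (u + a * v)| ≤ η * max |u| |v|) (he : |e - (v - a * u)| ≤ η * max |u| |v|) :
    (1 + a ^ 2 - 4 * (1 + |a|) * η) * (u ^ 2 + v ^ 2) ≤ d ^ 2 + e ^ 2 := by
  set m := max |u| |v| with hm
  have hm0 : 0 ≤ m := (abs_nonneg u).trans (le_max_left _ _)
  have hu : |u| ≤ m := le_max_left _ _
  have hv : |v| ≤ m := le_max_right _ _
  have hmN : m ^ 2 ≤ u ^ 2 + v ^ 2 := by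
    rcases max_choice |u| |v| with h | h <;> rw [hm, h, sq_abs] <;>
      nlinarith [sq_nonneg u, sq_nonneg v]
  have hA : |u + a * v| ≤ (1 + |a|) * m := by
    calc |u + a * v| ≤ |u| + |a| * |v| := by rw [← abs_mul]; exact abs_add_le _ _
      _ ≤ m + |a| * m := by gcongr
      _ = _ := by ring
  have hA' : |v - a * u| ≤ (1 + |a|) * m := by
    calc |v - a * u| ≤ |v| + |a| * |u| := by rw [← abs_mul]; exact abs_sub _ _
      _ ≤ m + |a| * m := by gcongr
      _ = _ := by ring
  have h₁ : |(u + a * v) * (d - (u + a * v))| ≤ (1 + |a|) * m * (η * m) := by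
    rw [abs_mul]; gcongr
  have h₂ : |(v - a * u) * (e - (v - a * u))| ≤ (1 + |a|) * m * (η * m) := by
    rw [abs_mul]; gcongr
  have hη : 0 ≤ η ∨ m = 0 := by
    rcases hm0.eq_or_lt with h | h
    · exact Or.inr h.symm
    · exact Or.inl (nonneg_of_mul_nonneg_left ((abs_nonneg _).trans hd) h)
  have key : (1 + |a|) * m * (η * m) ≤ (1 + |a|) * η * (u ^ 2 + v ^ 2) := by
    rcases hη with h | h
    · calc (1 + |a|) * m * (η * m) = (1 + |a|) * η * m ^ 2 := by ring
        _ ≤ _ := by gcongr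
    · have hu0 : u = 0 := abs_nonpos_iff.mp (h ▸ hu)
      have hv0 : v = 0 := abs_nonpos_iff.mp (h ▸ hv)
      simp [h, hu0, hv0]
  have h₁' := (abs_le.mp h₁).1
  have h₂' := (abs_le.mp h₂).1
  nlinarith [sq_nonneg (d - (u + a * v)), sq_nonneg (e - (v - a * u))]

/-- Near `(x̄, 0)` the map `(p, σ) ↦ (p + σ f'(p), σ - f(p))` expands squared Euclidean distances
by any factor below `1 + f'(x̄)²`. -/
lemma eventually_expanding {f g : ℝ → ℝ} {xbar g' Q : ℝ}
    (hf : HasStrictDerivAt f (g xbar) xbar) (hg : HasStrictDerivAt g g' xbar)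
    (hQ : Q < 1 + g xbar ^ 2) :
    ∀ᶠ y : (ℝ × ℝ) × (ℝ × ℝ) in 𝓝 ((xbar, 0), (xbar, 0)),
      Q * ((y.1.1 - y.2.1) ^ 2 + (y.1.2 - y.2.2) ^ 2) ≤
        ((y.1.1 + y.1.2 * g y.1.1) - (y.2.1 + y.2.2 * g y.2.1)) ^ 2 +
          ((y.1.2 - f y.1.1) - (y.2.2 - f y.2.1)) ^ 2 := by
  set a := g xbar with ha
  obtain ⟨η, hη, hηQ⟩ : ∃ η > 0, Q ≤ 1 + a ^ 2 - 4 * (1 + |a|) * η := by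
    refine ⟨(1 + a ^ 2 - Q) / (4 * (1 + |a|)), div_pos (by linarith) (by positivity), ?_⟩
    rw [mul_div_cancel₀ _ (by positivity)]
    linarith
  have hfst : HasStrictFDerivAt (Prod.fst : ℝ × ℝ → ℝ) (.fst ℝ ℝ ℝ) (xbar, 0) :=
    hasStrictFDerivAt_fst
  have hsnd : HasStrictFDerivAt (Prod.snd : ℝ × ℝ → ℝ) (.snd ℝ ℝ ℝ) (xbar, 0) :=
    hasStrictFDerivAt_snd
  have h₁ := (hfst.add (hsnd.mul
    (hg.comp_hasStrictFDerivAt (xbar, (0 : ℝ)) hfst))).isLittleO.def hη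
  have h₂ := (hsnd.sub (hf.comp_hasStrictFDerivAt (xbar, (0 : ℝ)) hfst)).isLittleO.def hη
  filter_upwards [h₁, h₂] with y hy₁ hy₂
  refine (mul_le_mul_of_nonneg_right hηQ (by positivity)).trans (le_sq_add_sq_of_abs_le ?_ ?_)
  · simpa [Prod.norm_def, ← ha] using hy₁
  · simpa [Prod.norm_def, ← ha] using hy₂

/-- Near `(x̄, 0)` the operator `T_{A,B}` is Lipschitz with any constant above
`1 / √(1 + f'(x̄)²)`. -/
lemma exists_drT_lipschitz {s : Set ℝ} {f f' : ℝ → ℝ} {xbar ε₀ f'' c : ℝ} (hfx : f xbar = 0)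
    (hε₀ : 0 < ε₀) (hball : Metric.ball xbar ε₀ ⊆ s)
    (hderiv : ∀ x ∈ Metric.ball xbar ε₀, HasDerivAt f (f' x) x)
    (hstrict : HasStrictDerivAt f' f'' xbar) (hc : 1 / Real.sqrt (1 + f' xbar ^ 2) < c) :
    ∃ δ > 0, ∀ z z' w w' : ℝ × ℝ, dist2 z (xbar, 0) ≤ δ → dist2 z' (xbar, 0) ≤ δ →
      w ∈ drT s f z → w' ∈ drT s f z' → dist2 w w' ≤ c * dist2 z z' := by
  have hsqrt : 0 < Real.sqrt (1 + f' xbar ^ 2) := Real.sqrt_pos.mpr (by positivity)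
  have hc0 : 0 < c := (by positivity : 0 < 1 / Real.sqrt (1 + f' xbar ^ 2)).trans hc
  have hQ : 1 / c ^ 2 < 1 + f' xbar ^ 2 := by
    rw [div_lt_iff₀ hsqrt] at hc
    rw [div_lt_iff₀ (by positivity), ← Real.sq_sqrt (by positivity : 0 ≤ 1 + f' xbar ^ 2)]
    nlinarith
  have hf : HasStrictDerivAt f (f' xbar) xbar :=
    hasStrictDerivAt_of_hasDerivAt_of_continuousAt
      (by filter_upwards [ball_mem_nhds xbar hε₀] with x hx using hderiv x hx)
      hstrict.hasDerivAt.continuousAt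
  obtain ⟨r, hr, hexp⟩ := Metric.eventually_nhds_iff.mp (eventually_expanding hf hstrict hQ)
  have hxs : xbar ∈ s := hball (mem_ball_self hε₀)
  refine ⟨min r ε₀ / 3, by positivity, fun z z' w w' hz hz' hw hw' => ?_⟩
  have hmin : 0 < min r ε₀ := lt_min hr hε₀
  have near : ∀ z w : ℝ × ℝ, dist2 z (xbar, 0) ≤ min r ε₀ / 3 → w ∈ drT s f z →
      dist w (xbar, 0) < r ∧ z.1 = w.1 + w.2 * f' w.1 ∧ z.2 = w.2 - f w.1 := by
    intro z w hz hw
    obtain ⟨h₁, h₂⟩ := abs_sub_le_of_mem_drT hxs hfx hw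
    have hw1 : w.1 ∈ ball xbar ε₀ := by
      rw [mem_ball, Real.dist_eq]
      linarith [min_le_right r ε₀]
    refine ⟨?_, fst_eq_of_mem_drT hw (mem_of_superset (isOpen_ball.mem_nhds hw1) hball)
      (hderiv _ hw1), by linarith [(mem_drT_iff.mp hw).2]⟩
    rw [Prod.dist_eq, Real.dist_eq, Real.dist_eq, sub_zero]
    exact max_lt (by linarith [min_le_left r ε₀]) (by linarith [min_le_left r ε₀])
  obtain ⟨hd, h1, h2⟩ := near z w hz hw
  obtain ⟨hd', h1', h2'⟩ := near z' w' hz' hw'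
  have h := @hexp (w, w') (by rw [Prod.dist_eq]; exact max_lt hd hd')
  simp only [← h1, ← h2, ← h1', ← h2'] at h
  refine le_of_sq_le_sq ?_ (mul_nonneg hc0.le (dist2_nonneg _ _))
  rw [mul_pow, dist2_sq, dist2_sq, Real.norm_eq_abs, Real.norm_eq_abs, sq_abs, sq_abs]
  rwa [one_div, inv_mul_le_iff₀ (by positivity)] at h

/-- Local `Q`-linear convergence of the DRA (`X = ℝ`).  Suppose `f(x̄) = 0`, `f` is
differentiable on a neighborhood of `x̄` with derivative function `f'` which is strictly
differentiable at `x̄`, and `f'(x̄) ≠ 0`.  Set `z̄ := (x̄, 0)` and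
`κ := 1/√(1 + f'(x̄)²)`.  Then there is `δ > 0` such that `T_{A,B}` is single-valued on
the closed (Euclidean) ball of radius `δ` about `z̄`, maps this ball into itself, is a
contraction there, and every DR sequence starting in this ball converges to `z̄` with
`Q`-linear rate `κ`, i.e. for every `c > κ`, eventually
`‖z_{n+1} - z̄‖ ≤ c ‖z_n - z̄‖`. -/
theorem stmt14 (s : Set ℝ) (f : ℝ → ℝ) (hs : s.Nonempty) (hB : IsClosed (grph s f))
    (xbar : ℝ) (hxs : xbar ∈ s) (hfx : f xbar = 0)
    (f' : ℝ → ℝ) (ε₀ : ℝ) (hε₀ : 0 < ε₀) (hball : Metric.ball xbar ε₀ ⊆ s)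
    (hderiv : ∀ x ∈ Metric.ball xbar ε₀, HasDerivAt f (f' x) x)
    (f'' : ℝ) (hstrict : HasStrictDerivAt f' f'' xbar)
    (hne : f' xbar ≠ 0) :
    ∃ δ > 0,
      (∀ z : ℝ × ℝ, dist2 z (xbar, 0) ≤ δ → ∃! w, w ∈ drT s f z) ∧
      (∀ z w : ℝ × ℝ, dist2 z (xbar, 0) ≤ δ → w ∈ drT s f z →
        dist2 w (xbar, 0) ≤ δ) ∧
      (∃ c : ℝ, 0 ≤ c ∧ c < 1 ∧ ∀ z z' w w' : ℝ × ℝ,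
        dist2 z (xbar, 0) ≤ δ → dist2 z' (xbar, 0) ≤ δ →
        w ∈ drT s f z → w' ∈ drT s f z' → dist2 w w' ≤ c * dist2 z z') ∧
      (∀ z : ℕ → ℝ × ℝ, dist2 (z 0) (xbar, 0) ≤ δ →
        (∀ n, z (n + 1) ∈ drT s f (z n)) →
        Tendsto z atTop (nhds (xbar, 0)) ∧
        ∀ c : ℝ, 1 / Real.sqrt (1 + f' xbar ^ 2) < c →
          ∃ N, ∀ n ≥ N, dist2 (z (n + 1)) (xbar, 0) ≤ c * dist2 (z n) (xbar, 0)) := by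
  have hκ : 1 / Real.sqrt (1 + f' xbar ^ 2) < 1 := by
    rw [div_lt_one (Real.sqrt_pos.mpr (by positivity)), Real.lt_sqrt one_pos.le]
    have : 0 < f' xbar ^ 2 := by positivity
    linarith
  obtain ⟨c, hκc, hc1⟩ := exists_between hκ
  have hc0 : 0 ≤ c := (by positivity : 0 ≤ 1 / Real.sqrt (1 + f' xbar ^ 2)).trans hκc.le
  obtain ⟨δ, hδ, hlip⟩ := exists_drT_lipschitz hfx hε₀ hball hderiv hstrict hκc
  have hfix : ((xbar, 0) : ℝ × ℝ) ∈ drT s f (xbar, 0) := by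
    refine mem_drT_iff.mpr ⟨⟨⟨hxs, rfl⟩, fun b' _ => ?_⟩, by simp [hfx]⟩
    rw [show dist2 (reflA (xbar, (0 : ℝ))) (xbar, f xbar) = 0 by simp [dist2, reflA, hfx]]
    exact dist2_nonneg _ _
  have hdec : ∀ z w : ℝ × ℝ, dist2 z (xbar, 0) ≤ δ → w ∈ drT s f z →
      dist2 w (xbar, 0) ≤ c * dist2 z (xbar, 0) := fun z w hz hw =>
    hlip z _ w _ hz (by rw [dist2_self]; exact hδ.le) hw hfix
  have hself : ∀ z w : ℝ × ℝ, dist2 z (xbar, 0) ≤ δ → w ∈ drT s f z →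
      dist2 w (xbar, 0) ≤ δ := fun z w hz hw =>
    (hdec z w hz hw).trans ((mul_le_of_le_one_left (dist2_nonneg _ _) hc1.le).trans hz)
  refine ⟨δ, hδ, fun z hz => ?_, hself, ⟨c, hc0, hc1, hlip⟩, fun z hz0 hz => ?_⟩
  · obtain ⟨b, hb⟩ := projB_nonempty hB ⟨(xbar, 0), hxs, hfx⟩ (reflA z)
    refine ⟨_, ⟨b, hb, rfl⟩, fun w hw => dist_le_zero.mp ((dist_le_dist2 _ _).trans ?_)⟩
    simpa [dist2_self] using hlip z z w _ hz hz hw ⟨b, hb, rfl⟩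
  · have hmem : ∀ n, dist2 (z n) (xbar, 0) ≤ δ := fun n => by
      induction n with
      | zero => exact hz0
      | succ n ih => exact hself _ _ ih (hz n)
    have hgeom : ∀ n, dist2 (z n) (xbar, 0) ≤ c ^ n * δ := fun n => by
      induction n with
      | zero => simpa using hz0
      | succ n ih =>
        calc dist2 (z (n + 1)) (xbar, 0) ≤ c * dist2 (z n) (xbar, 0) := hdec _ _ (hmem n) (hz n)
          _ ≤ c * (c ^ n * δ) := by gcongr
          _ = c ^ (n + 1) * δ := by ring
    have hlim : Tendsto (fun n => dist2 (z n) (xbar, 0)) atTop (𝓝 0) :=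
      squeeze_zero (fun _ => dist2_nonneg _ _) hgeom
        (by simpa using (tendsto_pow_atTop_nhds_zero_of_lt_one hc0 hc1).mul_const δ)
    refine ⟨tendsto_iff_dist_tendsto_zero.mpr
      (squeeze_zero (fun _ => dist_nonneg) (fun _ => dist_le_dist2 _ _) hlim), fun c' hc' => ?_⟩
    obtain ⟨δ', hδ', hlip'⟩ := exists_drT_lipschitz hfx hε₀ hball hderiv hstrict hc'
    obtain ⟨N, hN⟩ := eventually_atTop.mp (hlim.eventually_le_const hδ')
    exact ⟨N, fun n hn => hlip' _ _ _ _ (hN n hn) (by rw [dist2_self]; exact hδ'.le) (hz n) hfix⟩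
end
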